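/- arXiv:2103.10682 — 4 statements merged into one kernel-verified Lean document; each statement's English description precedes it below -/
import Mathlib

section
/- The partition function of the masked model converges to the restricted partition function: ∑ over all paths p of exp(s(p, l, Ā(A, c))) → ∑ over all legal paths p of exp(s(p, l, A)) as c → -∞. -/
open Finset Filter Topology

/-- The score of a path `p` given emission logits `l` and transition matrix `A`:
the sum of emission scores plus the sum of transition scores over consecutive pairs. -/
def score {n d : ℕ} (l : Fin (n + 1) → Fin d → ℝ) (A : Fin d → Fin d → ℝ)
    (p : Fin (n + 1) → Fin d) : ℝ :=
  (∑ i, l i (p i)) + ∑ i : Fin n, A (p i.castSucc) (p i.succ)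

/-- The masked transition matrix: entries in the illegal set `Ω` are replaced by `c`. -/
def masked {d : ℕ} (Ω : Finset (Fin d × Fin d)) (A : Fin d → Fin d → ℝ) (c : ℝ) :
    Fin d → Fin d → ℝ :=
  fun i j => if (i, j) ∈ Ω then c else A i j

/-- A path is legal if it contains no illegal transition. -/
def Legal {n d : ℕ} (Ω : Finset (Fin d × Fin d)) (p : Fin (n + 1) → Fin d) : Prop :=
  ∀ i : Fin n, (p i.castSucc, p i.succ) ∉ Ω

instance {n d : ℕ} (Ω : Finset (Fin d × Fin d)) : DecidablePred (Legal (n := n) Ω) :=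
  fun _ => by unfold Legal; infer_instance

/-- Partition function: sum of exponentiated scores over all paths. -/
noncomputable def partAll {n d : ℕ} (l : Fin (n + 1) → Fin d → ℝ)
    (A : Fin d → Fin d → ℝ) : ℝ :=
  ∑ p : Fin (n + 1) → Fin d, Real.exp (score l A p)

/-- Restricted partition function: sum of exponentiated scores over legal paths. -/
noncomputable def partLegal {n d : ℕ} (Ω : Finset (Fin d × Fin d))
    (l : Fin (n + 1) → Fin d → ℝ) (A : Fin d → Fin d → ℝ) : ℝ :=
  ∑ p ∈ Finset.univ.filter (Legal Ω), Real.exp (score l A p)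

/-- The CRF likelihood of a ground-truth path `y`. -/
noncomputable def Lik {n d : ℕ} (y : Fin (n + 1) → Fin d) (l : Fin (n + 1) → Fin d → ℝ)
    (A : Fin d → Fin d → ℝ) : ℝ :=
  Real.exp (score l A y) / partAll l A

/-- The masked-CRF likelihood of a ground-truth path `y`. -/
noncomputable def LikM {n d : ℕ} (Ω : Finset (Fin d × Fin d)) (y : Fin (n + 1) → Fin d)
    (l : Fin (n + 1) → Fin d → ℝ) (A : Fin d → Fin d → ℝ) : ℝ :=
  Real.exp (score l A y) / partLegal Ω l A

/-- The CRF loss over a family of `N` training samples. -/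
noncomputable def crfLoss {n d : ℕ} (N : ℕ) (l : Fin N → Fin (n + 1) → Fin d → ℝ)
    (y : Fin N → Fin (n + 1) → Fin d) (A : Fin d → Fin d → ℝ) : ℝ :=
  -(1 / (N : ℝ)) * ∑ k, Real.log (Lik (y k) (l k) A)

/-- The masked-CRF loss over a family of `N` training samples. -/
noncomputable def mcrfLoss {n d : ℕ} (Ω : Finset (Fin d × Fin d)) (N : ℕ)
    (l : Fin N → Fin (n + 1) → Fin d → ℝ) (y : Fin N → Fin (n + 1) → Fin d)
    (A : Fin d → Fin d → ℝ) : ℝ :=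
  -(1 / (N : ℝ)) * ∑ k, Real.log (LikM Ω (y k) (l k) A)

/-- Masking does not change the score of a legal path. -/
theorem score_masked_of_legal {n d : ℕ} {Ω : Finset (Fin d × Fin d)}
    {p : Fin (n + 1) → Fin d} (hp : Legal Ω p) (l : Fin (n + 1) → Fin d → ℝ)
    (A : Fin d → Fin d → ℝ) (c : ℝ) :
    score l (masked Ω A c) p = score l A p := by
  simp only [score, masked, if_neg (hp _)]

/-- The masked score of a path is affine in the mask value, with slope the number of illegal
transitions. -/
theorem score_masked_eq {n d : ℕ} (Ω : Finset (Fin d × Fin d)) (l : Fin (n + 1) → Fin d → ℝ)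
    (A : Fin d → Fin d → ℝ) (p : Fin (n + 1) → Fin d) (c : ℝ) :
    score l (masked Ω A c) p =
      score l (masked Ω A 0) p + #{i : Fin n | (p i.castSucc, p i.succ) ∈ Ω} * c := by
  simp only [score, masked, Finset.sum_ite, Finset.sum_const, nsmul_eq_mul]
  ring

theorem tendsto_score_masked_atBot {n d : ℕ} {Ω : Finset (Fin d × Fin d)}
    {p : Fin (n + 1) → Fin d} (hp : ¬ Legal Ω p) (l : Fin (n + 1) → Fin d → ℝ)
    (A : Fin d → Fin d → ℝ) :
    Tendsto (fun c : ℝ => score l (masked Ω A c) p) atBot atBot := by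
  obtain ⟨i, hi⟩ : ∃ i : Fin n, (p i.castSucc, p i.succ) ∈ Ω := by
    simpa [Legal] using hp
  have hcard : 0 < #{i : Fin n | (p i.castSucc, p i.succ) ∈ Ω} :=
    Finset.card_pos.mpr ⟨i, by simpa using hi⟩
  rw [funext (score_masked_eq Ω l A p)]
  exact tendsto_atBot_add_const_left _ _
    (tendsto_id.const_mul_atBot (Nat.cast_pos.mpr hcard))

/-- the masked partition function converges to the legal-paths partition
function as `c → -∞`. -/
theorem stmt_3 {n d : ℕ} (hd : 1 ≤ d) (Ω : Finset (Fin d × Fin d))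
    (l : Fin (n + 1) → Fin d → ℝ) (A : Fin d → Fin d → ℝ) :
    Tendsto (fun c : ℝ => partAll l (masked Ω A c)) atBot (𝓝 (partLegal Ω l A)) := by
  unfold partAll partLegal
  rw [Finset.sum_filter]
  refine tendsto_finsetSum _ fun p _ => ?_
  split_ifs with hp
  · simp_rw [score_masked_of_legal hp]
    exact tendsto_const_nhds
  · exact Real.tendsto_exp_atBot.comp (tendsto_score_masked_atBot hp l A)
end

section
/- (Lemma 1, part (13)) Let l : E → Fin T → Fin d → ℝ be differentiable at W₀ ∈ E and let y be a legal path. Then for every c ∈ ℝ the map W ↦ L(l W, Ā(A₀, c)) and the map W ↦ L'(l W, A₀) are differentiable at W₀, and the Fréchet derivative of W ↦ L(l W, Ā(A₀, c)) at W₀ converges, in the operator norm on continuous linear maps E → ℝ, to the Fréchet derivative of W ↦ L'(l W, A₀) at W₀ as c → -∞. -/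
open Finset Filter Topology

/-- The derivative of a weighted quotient `w y * g y / ∑ p, w p * g p`. -/
theorem hasFDerivAt_weighted_quotient {E ι : Type*} [NormedAddCommGroup E] [NormedSpace ℝ E]
    [Fintype ι] {g : ι → E → ℝ} {g' : ι → E →L[ℝ] ℝ} {x : E}
    (hg : ∀ p, HasFDerivAt (g p) (g' p) x) (w : ι → ℝ) (y : ι) (hw : ∑ p, w p * g p x ≠ 0) :
    HasFDerivAt (fun z => w y * g y z / ∑ p, w p * g p z)
      ((w y * g y x) • (-((∑ p, w p * g p x) ^ 2)⁻¹ • ∑ p, w p • g' p) +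
        (∑ p, w p * g p x)⁻¹ • (w y • g' y)) x := by
  have hS : HasFDerivAt (fun z => ∑ p, w p * g p z) (∑ p, w p • g' p) x :=
    HasFDerivAt.fun_sum fun p _ => (hg p).const_mul (w p)
  simp only [div_eq_mul_inv]
  exact ((hg y).const_mul (w y)).mul ((hasDerivAt_inv hw).comp_hasFDerivAt x hS)

/-- The derivative of a weighted quotient depends continuously on the weights. -/
theorem tendsto_fderiv_weighted_quotient {E ι α : Type*} [NormedAddCommGroup E]
    [NormedSpace ℝ E] [Fintype ι] {g : ι → E → ℝ} {x : E}
    (hg : ∀ p, DifferentiableAt ℝ (g p) x) {F : Filter α} {w : α → ι → ℝ} {v : ι → ℝ}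
    (hwv : ∀ p, Tendsto (fun a => w a p) F (𝓝 (v p))) (y : ι)
    (hw : ∀ a, ∑ p, w a p * g p x ≠ 0) (hv : ∑ p, v p * g p x ≠ 0) :
    Tendsto (fun a => fderiv ℝ (fun z => w a y * g y z / ∑ p, w a p * g p z) x) F
      (𝓝 (fderiv ℝ (fun z => v y * g y z / ∑ p, v p * g p z) x)) := by
  have hg' := fun p => (hg p).hasFDerivAt
  simp only [fun a => (hasFDerivAt_weighted_quotient hg' (w a) y (hw a)).fderiv,
    (hasFDerivAt_weighted_quotient hg' v y hv).fderiv]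
  have hS : Tendsto (fun a => ∑ p, w a p * g p x) F (𝓝 (∑ p, v p * g p x)) :=
    tendsto_finsetSum _ fun p _ => (hwv p).mul_const _
  exact (((hwv y).mul_const _).smul (((hS.pow 2).inv₀ (pow_ne_zero 2 hv)).neg.smul
    (tendsto_finsetSum _ fun p _ => (hwv p).smul_const _))).add
    ((hS.inv₀ hv).smul ((hwv y).smul_const _))

/-- The exponentiated transition score of a path. -/
noncomputable def transWeight {n d : ℕ} (A : Fin d → Fin d → ℝ) (p : Fin (n + 1) → Fin d) : ℝ :=
  Real.exp (∑ i : Fin n, A (p i.castSucc) (p i.succ))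

theorem transWeight_pos {n d : ℕ} (A : Fin d → Fin d → ℝ) (p : Fin (n + 1) → Fin d) :
    0 < transWeight A p :=
  Real.exp_pos _

/-- The exponentiated emission score of a path. -/
noncomputable def emitWeight {n d : ℕ} (p : Fin (n + 1) → Fin d)
    (l : Fin (n + 1) → Fin d → ℝ) : ℝ :=
  Real.exp (∑ i, l i (p i))

theorem emitWeight_pos {n d : ℕ} (p : Fin (n + 1) → Fin d) (l : Fin (n + 1) → Fin d → ℝ) :
    0 < emitWeight p l :=
  Real.exp_pos _

theorem exp_score {n d : ℕ} (l : Fin (n + 1) → Fin d → ℝ) (A : Fin d → Fin d → ℝ)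
    (p : Fin (n + 1) → Fin d) :
    Real.exp (score l A p) = transWeight A p * emitWeight p l := by
  rw [score, Real.exp_add, mul_comm, transWeight, emitWeight]

theorem transWeight_masked_of_legal {n d : ℕ} {Ω : Finset (Fin d × Fin d)}
    {p : Fin (n + 1) → Fin d} (hp : Legal Ω p) (A : Fin d → Fin d → ℝ) (c : ℝ) :
    transWeight (masked Ω A c) p = transWeight A p := by
  simp only [transWeight, masked, if_neg (hp _)]

theorem tendsto_transWeight_masked_of_not_legal {n d : ℕ} {Ω : Finset (Fin d × Fin d)}
    {p : Fin (n + 1) → Fin d} (hp : ¬ Legal Ω p) (A : Fin d → Fin d → ℝ) :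
    Tendsto (fun c => transWeight (masked Ω A c) p) atBot (𝓝 0) := by
  obtain ⟨i, hi⟩ : ∃ i : Fin n, (p i.castSucc, p i.succ) ∈ Ω := by
    simpa [Legal] using hp
  have hfac (j : Fin n) : Tendsto
      (fun c => Real.exp (masked Ω A c (p j.castSucc) (p j.succ))) atBot
      (𝓝 (if (p j.castSucc, p j.succ) ∈ Ω then 0 else Real.exp (A (p j.castSucc) (p j.succ)))) := by
    by_cases hj : (p j.castSucc, p j.succ) ∈ Ω
    · simpa only [masked, if_pos hj] using Real.tendsto_exp_atBot
    · simp only [masked, if_neg hj, tendsto_const_nhds]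
  have h := tendsto_finsetProd univ fun j _ => hfac j
  rw [prod_eq_zero (M₀ := ℝ) (mem_univ i) (if_pos hi)] at h
  simpa only [transWeight, Real.exp_sum] using h

theorem Lik_eq {n d : ℕ} (y : Fin (n + 1) → Fin d) (l : Fin (n + 1) → Fin d → ℝ)
    (A : Fin d → Fin d → ℝ) :
    Lik y l A = transWeight A y * emitWeight y l / ∑ p, transWeight A p * emitWeight p l := by
  simp only [Lik, partAll, exp_score]

theorem LikM_eq {n d : ℕ} {Ω : Finset (Fin d × Fin d)} {y : Fin (n + 1) → Fin d}
    (hy : Legal Ω y) (l : Fin (n + 1) → Fin d → ℝ) (A : Fin d → Fin d → ℝ) :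
    LikM Ω y l A = (if Legal Ω y then transWeight A y else 0) * emitWeight y l /
      ∑ p, (if Legal Ω p then transWeight A p else 0) * emitWeight p l := by
  simp only [LikM, partLegal, exp_score, if_pos hy, sum_filter, ite_mul, zero_mul]

/-- Lemma 1, (13): differentiability of the likelihoods in the encoder
weights, and operator-norm convergence of the Fréchet derivative of the masked-matrix CRF
likelihood to the Fréchet derivative of the masked-CRF likelihood as `c → -∞`. -/
theorem stmt_5 {E : Type*} [NormedAddCommGroup E] [NormedSpace ℝ E]
    {n d : ℕ} (hd : 1 ≤ d) (Ω : Finset (Fin d × Fin d))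
    (l : E → Fin (n + 1) → Fin d → ℝ) (W₀ : E) (hl : DifferentiableAt ℝ l W₀)
    (y : Fin (n + 1) → Fin d) (hy : Legal Ω y) (A₀ : Fin d → Fin d → ℝ) :
    (∀ c : ℝ, DifferentiableAt ℝ (fun W => Lik y (l W) (masked Ω A₀ c)) W₀) ∧
    DifferentiableAt ℝ (fun W => LikM Ω y (l W) A₀) W₀ ∧
    Tendsto (fun c : ℝ => fderiv ℝ (fun W => Lik y (l W) (masked Ω A₀ c)) W₀) atBot
      (𝓝 (fderiv ℝ (fun W => LikM Ω y (l W) A₀) W₀)) := by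
  have hg (p : Fin (n + 1) → Fin d) : DifferentiableAt ℝ (fun W => emitWeight p (l W)) W₀ := by
    have hcoord (i : Fin (n + 1)) : DifferentiableAt ℝ (fun W => l W i (p i)) W₀ :=
      differentiableAt_pi.1 (differentiableAt_pi.1 hl i) (p i)
    exact (DifferentiableAt.fun_sum fun i _ => hcoord i).exp
  have hS (c : ℝ) : ∑ p, transWeight (masked Ω A₀ c) p * emitWeight p (l W₀) ≠ 0 :=
    (sum_pos (fun p _ => mul_pos (transWeight_pos _ p) (emitWeight_pos p _))
      ⟨y, mem_univ y⟩).ne'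
  have hSM : ∑ p, (if Legal Ω p then transWeight A₀ p else 0) * emitWeight p (l W₀) ≠ 0 := by
    refine (sum_pos' (fun p _ => mul_nonneg ?_ (emitWeight_pos p _).le) ⟨y, mem_univ y, ?_⟩).ne'
    · split_ifs
      exacts [(transWeight_pos _ p).le, le_rfl]
    · rw [if_pos hy]
      exact mul_pos (transWeight_pos _ y) (emitWeight_pos y _)
  have hlim (p : Fin (n + 1) → Fin d) : Tendsto (fun c => transWeight (masked Ω A₀ c) p) atBot
      (𝓝 (if Legal Ω p then transWeight A₀ p else 0)) := by
    split_ifs with hp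
    · simp only [transWeight_masked_of_legal hp, tendsto_const_nhds]
    · exact tendsto_transWeight_masked_of_not_legal hp A₀
  have hg' := fun p => (hg p).hasFDerivAt
  simp only [Lik_eq, LikM_eq hy]
  exact ⟨fun c => (hasFDerivAt_weighted_quotient hg' _ y (hS c)).differentiableAt,
    (hasFDerivAt_weighted_quotient hg' _ y hSM).differentiableAt,
    tendsto_fderiv_weighted_quotient hg hlim y hS hSM⟩
end

section
/- (Proposition 1, equation (9)) Fix an illegal transition (i, j) ∈ Ω, a finite nonempty family of training samples each with logits lₖ and legal ground-truth path yₖ, and a transition matrix A₀. For c ∈ ℝ, let gᶜ : ℝ → ℝ be the function sending t to the CRF loss ℒ(B) where B agrees with Ā(A₀, c) at all entries except that B i j = t. Then the derivative of gᶜ at t = c tends to 0 as c → -∞ (i.e., it converges to the derivative of the masked-CRF loss with respect to the masked entry, which is 0 since ℒ'(A) does not depend on entries of A indexed by Ω). -/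
open Finset Filter Topology

/-- The number of consecutive pairs of the path `p` that lie in `S`. -/
def transitionCount {n d : ℕ} (S : Finset (Fin d × Fin d)) (p : Fin (n + 1) → Fin d) : ℕ :=
  #{k : Fin n | (p k.castSucc, p k.succ) ∈ S}

theorem transitionCount_mono {n d : ℕ} {S S' : Finset (Fin d × Fin d)} (h : S ⊆ S')
    (p : Fin (n + 1) → Fin d) : transitionCount S p ≤ transitionCount S' p :=
  card_le_card (monotone_filter_right _ fun _ _ hk => h hk)

theorem Legal.transitionCount_eq_zero {n d : ℕ} {Ω : Finset (Fin d × Fin d)}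
    {p : Fin (n + 1) → Fin d} (hp : Legal Ω p) : transitionCount Ω p = 0 := by
  rw [transitionCount, card_eq_zero, filter_eq_empty_iff]
  exact fun k _ => hp k

theorem score_masked {n d : ℕ} (S : Finset (Fin d × Fin d)) (l : Fin (n + 1) → Fin d → ℝ)
    (A : Fin d → Fin d → ℝ) (c : ℝ) (p : Fin (n + 1) → Fin d) :
    score l (masked S A c) p = score l (masked S A 0) p + transitionCount S p * c := by
  have h (k : Fin n) : masked S A c (p k.castSucc) (p k.succ) =
      masked S A 0 (p k.castSucc) (p k.succ) +
        if (p k.castSucc, p k.succ) ∈ S then c else 0 := by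
    unfold masked
    split_ifs <;> simp
  simp only [score, h, sum_add_distrib, ← sum_filter, sum_const, nsmul_eq_mul, transitionCount]
  ring

theorem partAll_pos {n d : ℕ} (l : Fin (n + 1) → Fin d → ℝ) (A : Fin d → Fin d → ℝ)
    (y : Fin (n + 1) → Fin d) : 0 < partAll l A :=
  sum_pos (fun _ _ => Real.exp_pos _) ⟨y, mem_univ y⟩

theorem log_Lik {n d : ℕ} (y : Fin (n + 1) → Fin d) (l : Fin (n + 1) → Fin d → ℝ)
    (A : Fin d → Fin d → ℝ) : Real.log (Lik y l A) = score l A y - Real.log (partAll l A) := by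
  rw [Lik, Real.log_div (Real.exp_ne_zero _) (partAll_pos l A y).ne', Real.log_exp]

theorem hasDerivAt_score_masked {n d : ℕ} (S : Finset (Fin d × Fin d))
    (l : Fin (n + 1) → Fin d → ℝ) (A : Fin d → Fin d → ℝ) (p : Fin (n + 1) → Fin d) (c : ℝ) :
    HasDerivAt (fun t => score l (masked S A t) p) (transitionCount S p) c := by
  rw [funext fun t => score_masked S l A t p]
  simpa using ((hasDerivAt_id c).const_mul (transitionCount S p : ℝ)).const_add
    (score l (masked S A 0) p)

theorem hasDerivAt_log_Lik_masked {n d : ℕ} (S : Finset (Fin d × Fin d))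
    (y : Fin (n + 1) → Fin d) (l : Fin (n + 1) → Fin d → ℝ) (A : Fin d → Fin d → ℝ) (c : ℝ) :
    HasDerivAt (fun t => Real.log (Lik y l (masked S A t)))
      (transitionCount S y -
        (∑ p, Real.exp (score l (masked S A c) p) * transitionCount S p) /
          partAll l (masked S A c)) c := by
  simp only [log_Lik]
  refine (hasDerivAt_score_masked S l A y c).sub (HasDerivAt.log ?_ (partAll_pos l _ y).ne')
  exact HasDerivAt.fun_sum fun p _ => (hasDerivAt_score_masked S l A p c).exp

theorem tendsto_exp_score_masked {n d : ℕ} (S : Finset (Fin d × Fin d))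
    (l : Fin (n + 1) → Fin d → ℝ) (A : Fin d → Fin d → ℝ) (p : Fin (n + 1) → Fin d) :
    Tendsto (fun c => Real.exp (score l (masked S A c) p)) atBot
      (𝓝 (if transitionCount S p = 0 then Real.exp (score l (masked S A 0) p) else 0)) := by
  refine Tendsto.congr (fun c => congrArg Real.exp (score_masked S l A c p).symm) ?_
  split_ifs with h
  · simp [h]
  · refine Real.tendsto_exp_atBot.comp (tendsto_atBot_add_const_left _ _ ?_)
    exact tendsto_id.const_mul_atBot (by exact_mod_cast Nat.pos_of_ne_zero h)

/-- The expected number of transitions in `S ⊆ Ω`, under the masked model, vanishes in the limit. -/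
theorem tendsto_expected_transitionCount_masked {n d : ℕ} {S Ω : Finset (Fin d × Fin d)}
    (hS : S ⊆ Ω) (l : Fin (n + 1) → Fin d → ℝ) (A : Fin d → Fin d → ℝ)
    {y : Fin (n + 1) → Fin d} (hy : Legal Ω y) :
    Tendsto (fun c => (∑ p, Real.exp (score l (masked Ω A c) p) * transitionCount S p) /
      partAll l (masked Ω A c)) atBot (𝓝 0) := by
  have hden := tendsto_finsetSum univ fun p _ => tendsto_exp_score_masked Ω l A p
  have hnum := tendsto_finsetSum univ fun p _ =>
    (tendsto_exp_score_masked Ω l A p).mul_const (transitionCount S p : ℝ)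
  have hpos : 0 < ∑ p : Fin (n + 1) → Fin d,
      if transitionCount Ω p = 0 then Real.exp (score l (masked Ω A 0) p) else 0 := by
    refine sum_pos' (fun p _ => ?_) ⟨y, mem_univ y, ?_⟩
    · split_ifs <;> positivity
    · rw [if_pos hy.transitionCount_eq_zero]
      positivity
  have hzero : ∑ p : Fin (n + 1) → Fin d,
      (if transitionCount Ω p = 0 then Real.exp (score l (masked Ω A 0) p) else 0) *
        (transitionCount S p : ℝ) = 0 := by
    refine sum_eq_zero fun p _ => ?_
    split_ifs with h
    · rw [Nat.le_zero.mp ((transitionCount_mono hS p).trans_eq h), Nat.cast_zero, mul_zero]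
    · exact zero_mul _
  rw [hzero] at hnum
  rw [← zero_div]
  exact hnum.div hden hpos.ne'

/-- Proposition 1, (9): the derivative of the CRF loss with respect to a
masked entry `(i, j) ∈ Ω`, evaluated at the mask value `c`, tends to `0` as `c → -∞`. -/
theorem stmt_9 {n d : ℕ} (hd : 1 ≤ d) (Ω : Finset (Fin d × Fin d))
    (i j : Fin d) (hij : (i, j) ∈ Ω)
    (N : ℕ) (hN : 1 ≤ N)
    (l : Fin N → Fin (n + 1) → Fin d → ℝ) (y : Fin N → Fin (n + 1) → Fin d)
    (hy : ∀ k, Legal Ω (y k)) (A₀ : Fin d → Fin d → ℝ) :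
    Tendsto (fun c : ℝ =>
        deriv (fun t : ℝ =>
          crfLoss N l y (fun i' j' => if (i', j') = (i, j) then t else masked Ω A₀ c i' j')) c)
      atBot (𝓝 0) := by
  have hS : {(i, j)} ⊆ Ω := singleton_subset_iff.mpr hij
  have hentry (c t : ℝ) : (fun i' j' => if (i', j') = (i, j) then t else masked Ω A₀ c i' j') =
      masked {(i, j)} (masked Ω A₀ c) t := by
    funext i' j'
    simp [masked]
  have hself (c : ℝ) : masked {(i, j)} (masked Ω A₀ c) c = masked Ω A₀ c := by
    funext i' j'
    by_cases h : (i', j') = (i, j)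
    · simp [masked, h, hij]
    · simp [masked, h]
  have hderiv (c : ℝ) := HasDerivAt.const_mul (-(1 / (N : ℝ))) <|
    HasDerivAt.fun_sum (u := univ) fun k _ =>
      hasDerivAt_log_Lik_masked {(i, j)} (y k) (l k) (masked Ω A₀ c) c
  simp only [hentry, crfLoss, fun c => (hderiv c).deriv, hself]
  have hcount (k : Fin N) : transitionCount {(i, j)} (y k) = 0 :=
    Nat.le_zero.mp ((transitionCount_mono hS (y k)).trans_eq (hy k).transitionCount_eq_zero)
  simpa [hcount] using (tendsto_finsetSum univ fun k _ =>
    (tendsto_expected_transitionCount_masked hS (l k) A₀ (hy k)).const_sub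
      (transitionCount {(i, j)} (y k) : ℝ)).const_mul (-(1 / (N : ℝ)))
end

section
/- Let l : E → Fin T → Fin d → ℝ be differentiable at W₀ ∈ E and let p be an illegal path. Then the Fréchet derivative at W₀ of the map W ↦ exp(s(p, l W, Ā(A₀, c))) converges to the zero continuous linear map (in operator norm) as c → -∞. -/
open Finset Filter Topology

/-- The masked transition score of an illegal path tends to `-∞` with the mask value. -/
lemma tendsto_sum_masked_atBot {n d : ℕ} {Ω : Finset (Fin d × Fin d)}
    {p : Fin (n + 1) → Fin d} (hp : ¬ Legal Ω p) (A : Fin d → Fin d → ℝ) :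
    Tendsto (fun c : ℝ => ∑ i : Fin n, masked Ω A c (p i.castSucc) (p i.succ)) atBot atBot := by
  simp only [masked, Finset.sum_ite, Finset.sum_const, nsmul_eq_mul]
  refine tendsto_atBot_add_const_right _ _ (Tendsto.const_mul_atBot ?_ tendsto_id)
  simp only [Legal, not_forall, not_not] at hp
  obtain ⟨i, hi⟩ := hp
  exact_mod_cast Finset.card_pos.mpr ⟨i, by simpa using hi⟩

/-- The derivative of the exponentiated score with respect to the encoder weights. -/
lemma fderiv_exp_score {E : Type*} [NormedAddCommGroup E] [NormedSpace ℝ E] {n d : ℕ}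
    {l : E → Fin (n + 1) → Fin d → ℝ} {W₀ : E} (hl : DifferentiableAt ℝ l W₀)
    (A : Fin d → Fin d → ℝ) (p : Fin (n + 1) → Fin d) :
    fderiv ℝ (fun W => Real.exp (score (l W) A p)) W₀ =
      Real.exp (score (l W₀) A p) • fderiv ℝ (fun W => ∑ i, l W i (p i)) W₀ := by
  have hsum : DifferentiableAt ℝ (fun W => ∑ i, l W i (p i)) W₀ :=
    DifferentiableAt.fun_sum fun i _ =>
      differentiableAt_pi.mp (differentiableAt_pi.mp hl i) (p i)
  exact (hsum.hasFDerivAt.add_const _).exp.fderiv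

/-- for an illegal path `p`, the Fréchet derivative at `W₀` of
`W ↦ exp (s(p, l W, Ā(A₀, c)))` converges in operator norm to `0` as `c → -∞`. -/
theorem stmt_12 {E : Type*} [NormedAddCommGroup E] [NormedSpace ℝ E]
    {n d : ℕ} (hd : 1 ≤ d) (Ω : Finset (Fin d × Fin d))
    (l : E → Fin (n + 1) → Fin d → ℝ) (W₀ : E) (hl : DifferentiableAt ℝ l W₀)
    (p : Fin (n + 1) → Fin d) (hp : ¬ Legal Ω p) (A₀ : Fin d → Fin d → ℝ) :
    Tendsto (fun c : ℝ =>
        fderiv ℝ (fun W => Real.exp (score (l W) (masked Ω A₀ c) p)) W₀) atBot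
      (𝓝 0) := by
  have hscore : Tendsto (fun c : ℝ => score (l W₀) (masked Ω A₀ c) p) atBot atBot :=
    tendsto_atBot_add_const_left _ _ (tendsto_sum_masked_atBot hp A₀)
  simp_rw [fderiv_exp_score hl]
  simpa using (Real.tendsto_exp_atBot.comp hscore).smul_const
    (fderiv ℝ (fun W => ∑ i, l W i (p i)) W₀)
end
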